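/- arXiv:2011.05200 — 2 statements merged into one kernel-verified Lean document; each statement's English description precedes it below -/
import Mathlib

section
/- Fix a real $q>1$ and $L>0$, and let $v^*$ be the unique positive real with $\bm{L}(v^*) = L/2$. Then for every real $n > v^*$ there exists a unique $v_n \in (0, v^*)$ such that $\bm{x}(n, v_n) = L/2$; moreover the map $n \mapsto v_n$ is strictly increasing on $(v^*, \infty)$ and $v_n \to v^*$ as $n \to \infty$. -/
open Set Filter MeasureTheory

/-- `I(q) = ∫_1^∞ (u^(q+1) - 1)^(-1/2) du` (Lebesgue integral over `Ioi 1`). -/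
noncomputable def Iq (q : ℝ) : ℝ :=
  ∫ u in Set.Ioi (1 : ℝ), (u ^ (q + 1) - 1) ^ (-(1 / 2) : ℝ)

/-- `x(v, v_l) = v_l^((1-q)/2) ((q+1)/4)^(1/2) ∫_1^{v/v_l} (u^(q+1)-1)^(-1/2) du`. -/
noncomputable def xfun (q v vl : ℝ) : ℝ :=
  vl ^ ((1 - q) / 2 : ℝ) * ((q + 1) / 4) ^ ((1 : ℝ) / 2) *
    ∫ u in Set.Ioc (1 : ℝ) (v / vl), (u ^ (q + 1) - 1) ^ (-(1 / 2) : ℝ)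

/-- `L(v_l) = v_l^((1-q)/2) ((q+1)/4)^(1/2) I(q)`. -/
noncomputable def Lfun (q vl : ℝ) : ℝ :=
  vl ^ ((1 - q) / 2 : ℝ) * ((q + 1) / 4) ^ ((1 : ℝ) / 2) * Iq q

/-- The integrand `(u^(q+1) - 1)^(-1/2)` is positive on `(1, ∞)`. -/
lemma integrand_pos {q u : ℝ} (hq : 1 < q) (hu : 1 < u) :
    0 < (u ^ (q + 1) - 1) ^ (-(1 / 2) : ℝ) :=
  Real.rpow_pos_of_pos (sub_pos.2 (Real.one_lt_rpow hu (by linarith))) _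

section Primitive

variable {f : ℝ → ℝ}

lemma strictMonoOn_setIntegral_Ioc {a : ℝ} (hf : IntegrableOn f (Ioi a))
    (hpos : ∀ u, a < u → 0 < f u) :
    StrictMonoOn (fun t => ∫ u in Ioc a t, f u) (Ici a) := by
  intro s hs t ht hst
  have hint : ∀ {b c : ℝ}, a ≤ b → b ≤ c → IntervalIntegrable f volume b c := fun hb hbc =>
    (intervalIntegrable_iff_integrableOn_Ioc_of_le hbc).2
      (hf.mono_set fun _ hx => lt_of_le_of_lt hb hx.1)
  have h := intervalIntegral.intervalIntegral_pos_of_pos_on (hint hs hst.le)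
    (fun u hu => hpos u (lt_of_le_of_lt hs hu.1)) hst
  have hadd := intervalIntegral.integral_add_adjacent_intervals (hint le_rfl hs) (hint hs hst.le)
  rw [intervalIntegral.integral_of_le hs, intervalIntegral.integral_of_le ht] at hadd
  change ∫ u in Ioc a s, f u < ∫ u in Ioc a t, f u
  linarith

lemma setIntegral_Ioc_lt_setIntegral_Ioi {a t : ℝ} (hf : IntegrableOn f (Ioi a))
    (hpos : ∀ u, a < u → 0 < f u) (ht : a ≤ t) :
    ∫ u in Ioc a t, f u < ∫ u in Ioi a, f u := by
  refine (strictMonoOn_setIntegral_Ioc hf hpos (mem_Ici.2 ht)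
    (mem_Ici.2 (by linarith : a ≤ t + 1)) (lt_add_one t)).trans_le ?_
  refine setIntegral_mono_set hf ?_ (Eventually.of_forall fun u hu => hu.1)
  exact (ae_restrict_iff' measurableSet_Ioi).2 (Eventually.of_forall fun u hu => (hpos u hu).le)

lemma tendsto_setIntegral_Ioc_atTop {a : ℝ} (hf : IntegrableOn f (Ioi a)) :
    Tendsto (fun t => ∫ u in Ioc a t, f u) atTop (nhds (∫ u in Ioi a, f u)) := by
  refine (intervalIntegral_tendsto_integral_Ioi a hf tendsto_id).congr' ?_
  filter_upwards [eventually_ge_atTop a] with t ht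
  exact intervalIntegral.integral_of_le ht

lemma continuousOn_setIntegral_Ioc {a : ℝ} (hf : IntegrableOn f (Ioi a)) (b : ℝ) :
    ContinuousOn (fun t => ∫ u in Ioc a t, f u) (Icc a b) :=
  intervalIntegral.continuousOn_primitive
    ((integrableOn_Icc_iff_integrableOn_Ioc (by simp)).2 (hf.mono_set fun _ hx => hx.1))

end Primitive

section Scaling

variable {q : ℝ}

lemma xfun_strictAntiOn (hq : 1 < q)
    (hf : IntegrableOn (fun u : ℝ => (u ^ (q + 1) - 1) ^ (-(1 / 2) : ℝ)) (Ioi 1)) (n : ℝ) :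
    StrictAntiOn (xfun q n) (Ioo 0 n) := by
  intro w hw v hv hwv
  have hmono := strictMonoOn_setIntegral_Ioc hf fun u hu => integrand_pos hq hu
  have hv1 : 1 < n / v := (one_lt_div hv.1).2 hv.2
  have hlt : n / v < n / w := div_lt_div_of_pos_left (hv.1.trans hv.2) hw.1 hwv
  have hF := hmono (mem_Ici.2 hv1.le) (mem_Ici.2 (hv1.trans hlt).le) hlt
  have hF0 := hmono (mem_Ici.2 le_rfl) (mem_Ici.2 hv1.le) hv1
  simp only [Ioc_self, Measure.restrict_empty, integral_zero_measure] at hF0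
  have hc : 0 < ((q + 1) / 4) ^ ((1 : ℝ) / 2) := Real.rpow_pos_of_pos (by linarith) _
  have hpow : v ^ ((1 - q) / 2) < w ^ ((1 - q) / 2) :=
    Real.rpow_lt_rpow_of_neg hw.1 hwv (by linarith)
  unfold xfun
  exact mul_lt_mul'' (mul_lt_mul_of_pos_right hpow hc) hF
    (mul_pos (Real.rpow_pos_of_pos hv.1 _) hc).le hF0.le

lemma xfun_strictMonoOn_left (hq : 1 < q)
    (hf : IntegrableOn (fun u : ℝ => (u ^ (q + 1) - 1) ^ (-(1 / 2) : ℝ)) (Ioi 1))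
    {w : ℝ} (hw : 0 < w) : StrictMonoOn (fun n => xfun q n w) (Ici w) := by
  intro m hm n hn hmn
  refine mul_lt_mul_of_pos_left (strictMonoOn_setIntegral_Ioc hf
    (fun u hu => integrand_pos hq hu) (mem_Ici.2 ((one_le_div hw).2 hm))
    (mem_Ici.2 ((one_le_div hw).2 hn)) (div_lt_div_of_pos_right hmn hw)) ?_
  exact mul_pos (Real.rpow_pos_of_pos hw _) (Real.rpow_pos_of_pos (by linarith) _)

lemma xfun_lt_Lfun (hq : 1 < q)
    (hf : IntegrableOn (fun u : ℝ => (u ^ (q + 1) - 1) ^ (-(1 / 2) : ℝ)) (Ioi 1))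
    {n w : ℝ} (hw : 0 < w) (hwn : w ≤ n) : xfun q n w < Lfun q w := by
  refine mul_lt_mul_of_pos_left (setIntegral_Ioc_lt_setIntegral_Ioi hf
    (fun u hu => integrand_pos hq hu) ((one_le_div hw).2 hwn)) ?_
  exact mul_pos (Real.rpow_pos_of_pos hw _) (Real.rpow_pos_of_pos (by linarith) _)

lemma tendsto_xfun_atTop
    (hf : IntegrableOn (fun u : ℝ => (u ^ (q + 1) - 1) ^ (-(1 / 2) : ℝ)) (Ioi 1))
    {w : ℝ} (hw : 0 < w) : Tendsto (fun n => xfun q n w) atTop (nhds (Lfun q w)) :=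
  ((tendsto_setIntegral_Ioc_atTop hf).comp (tendsto_id.atTop_div_const hw)).const_mul _

lemma Lfun_strictAntiOn (hq : 1 < q) (hI : 0 < Iq q) : StrictAntiOn (Lfun q) (Ioi 0) := by
  intro w hw v _ hwv
  have hc : 0 < ((q + 1) / 4) ^ ((1 : ℝ) / 2) := Real.rpow_pos_of_pos (by linarith) _
  exact mul_lt_mul_of_pos_right (mul_lt_mul_of_pos_right
    (Real.rpow_lt_rpow_of_neg hw hwv (by linarith)) hc) hI

lemma continuousOn_xfun
    (hf : IntegrableOn (fun u : ℝ => (u ^ (q + 1) - 1) ^ (-(1 / 2) : ℝ)) (Ioi 1))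
    {n a b : ℝ} (ha : 0 < a) (hbn : b ≤ n) : ContinuousOn (xfun q n) (Icc a b) := by
  have h0 : ∀ w ∈ Icc a b, w ≠ 0 := fun w hw => (ha.trans_le hw.1).ne'
  refine ContinuousOn.mul (ContinuousOn.mul (fun w hw =>
    (Real.continuousAt_rpow_const w _ (Or.inl (h0 w hw))).continuousWithinAt)
    continuousOn_const) ?_
  refine (continuousOn_setIntegral_Ioc hf (n / a)).comp
    (f := fun w => n / w) (continuousOn_const.div continuousOn_id h0) ?_
  intro w hw
  have hw0 := ha.trans_le hw.1
  have hn : w ≤ n := hw.2.trans hbn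
  exact ⟨(one_le_div hw0).2 hn, div_le_div_of_nonneg_left (hw0.le.trans hn) ha hw.1⟩

lemma tendsto_xfun_nhdsGT_zero (hq : 1 < q)
    (hf : IntegrableOn (fun u : ℝ => (u ^ (q + 1) - 1) ^ (-(1 / 2) : ℝ)) (Ioi 1))
    {n : ℝ} (hn : 0 < n) : Tendsto (xfun q n) (nhdsWithin 0 (Ioi 0)) atTop := by
  have hpow : Tendsto (fun w : ℝ => w ^ ((1 - q) / 2)) (nhdsWithin 0 (Ioi 0)) atTop :=
    tendsto_rpow_neg_nhdsGT_zero (by linarith)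
  have hc : 0 < ((q + 1) / 4) ^ ((1 : ℝ) / 2) := Real.rpow_pos_of_pos (by linarith) _
  have hI : 0 < Iq q := by
    simpa [Iq] using setIntegral_Ioc_lt_setIntegral_Ioi hf
      (fun u hu => integrand_pos hq hu) le_rfl
  exact (hpow.atTop_mul_const hc).atTop_mul_pos hI ((tendsto_setIntegral_Ioc_atTop hf).comp
    (tendsto_inv_nhdsGT_zero.const_mul_atTop hn))

end Scaling

/-- with `v*` the unique positive solution of `L(v*) = L/2`, for every
`n > v*` there is a unique `v_n ∈ (0, v*)` with `x(n, v_n) = L/2`; the map `n ↦ v_n`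
is strictly increasing on `(v*, ∞)` and `v_n → v*` as `n → ∞`. -/
theorem stmt5 (q L vstar : ℝ) (hq : 1 < q) (hL : 0 < L)
    (hvstar_pos : 0 < vstar) (hvstar_eq : Lfun q vstar = L / 2)
    (hvstar_unique : ∀ v : ℝ, 0 < v → Lfun q v = L / 2 → v = vstar) :
    ∃ vfun : ℝ → ℝ,
      (∀ n : ℝ, vstar < n →
        vfun n ∈ Set.Ioo 0 vstar ∧ xfun q n (vfun n) = L / 2 ∧
        ∀ w ∈ Set.Ioo (0 : ℝ) vstar, xfun q n w = L / 2 → w = vfun n) ∧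
      StrictMonoOn vfun (Set.Ioi vstar) ∧
      Tendsto vfun atTop (nhds vstar) := by
  have hI0 : Iq q ≠ 0 := fun h => by
    rw [Lfun, h, mul_zero] at hvstar_eq
    linarith
  have hf : IntegrableOn (fun u : ℝ => (u ^ (q + 1) - 1) ^ (-(1 / 2) : ℝ)) (Ioi 1) :=
    Integrable.of_integral_ne_zero hI0
  have hI : 0 < Iq q := lt_of_le_of_ne
    (setIntegral_nonneg measurableSet_Ioi fun u hu => (integrand_pos hq hu).le) hI0.symm
  have hex : ∀ n : ℝ, vstar < n → ∃ w ∈ Ioo 0 vstar, xfun q n w = L / 2 := by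
    intro n hn
    obtain ⟨a, hxa, ha⟩ := (((tendsto_xfun_nhdsGT_zero hq hf
      (hvstar_pos.trans hn)).eventually_ge_atTop (L / 2)).and
      (Ioo_mem_nhdsGT hvstar_pos)).exists
    have hlt : xfun q n vstar < L / 2 := hvstar_eq ▸ xfun_lt_Lfun hq hf hvstar_pos hn.le
    obtain ⟨w, hw, hxw⟩ := intermediate_value_Icc' ha.2.le
      (continuousOn_xfun hf ha.1 hn.le) ⟨hlt.le, hxa⟩
    refine ⟨w, ⟨ha.1.trans_le hw.1, lt_of_le_of_ne hw.2 ?_⟩, hxw⟩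
    rintro rfl
    exact hlt.ne hxw
  choose! v hv hxv using hex
  have hlow : ∀ n w, vstar < n → w ∈ Ioo 0 vstar → L / 2 < xfun q n w → w < v n := by
    intro n w hn hw hlt
    rw [← hxv n hn] at hlt
    exact ((xfun_strictAntiOn hq hf n).lt_iff_gt ⟨(hv n hn).1, (hv n hn).2.trans hn⟩
      ⟨hw.1, hw.2.trans hn⟩).1 hlt
  refine ⟨v, fun n hn => ⟨hv n hn, hxv n hn, fun w hw hxw => ?_⟩, fun m hm n hn hmn => ?_, ?_⟩
  · exact (xfun_strictAntiOn hq hf n).injOn ⟨hw.1, hw.2.trans hn⟩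
      ⟨(hv n hn).1, (hv n hn).2.trans hn⟩ (hxw.trans (hxv n hn).symm)
  · refine hlow n _ hn (hv m hm) ?_
    rw [← hxv m hm]
    exact xfun_strictMonoOn_left hq hf (hv m hm).1 (mem_Ici.2 ((hv m hm).2.trans hm).le)
      (mem_Ici.2 ((hv m hm).2.trans hn).le) hmn
  · refine tendsto_order.2 ⟨fun b hb => ?_, fun b hb => ?_⟩
    · obtain ⟨w, hw, hwv⟩ := exists_between (max_lt hb hvstar_pos)
      obtain ⟨hbw, hw0⟩ := max_lt_iff.1 hw
      have hlt : L / 2 < Lfun q w :=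
        hvstar_eq ▸ Lfun_strictAntiOn hq hI (mem_Ioi.2 hw0) (mem_Ioi.2 hvstar_pos) hwv
      filter_upwards [(tendsto_xfun_atTop hf hw0).eventually_const_lt hlt,
        eventually_gt_atTop vstar] with n hxn hn
      exact hbw.trans (hlow n w hn ⟨hw0, hwv⟩ hxn)
    · filter_upwards [eventually_gt_atTop vstar] with n hn
      exact (hv n hn).2.trans hb
end

section
/- Fix a real $q>1$, $v_l>0$ and $L>0$, and let $W_{v_l}$ be the inverse of $v \mapsto \bm{x}(v,v_l)$. Define $V(s) = W_{v_l}(|s - L/2|)$ for $s$ in the open interval $J = (L/2 - \bm{L}(v_l),\; L/2 + \bm{L}(v_l))$. Then $V$ is twice differentiable on $J$ and satisfies the ordinary differential equation $\tfrac{1}{2} V''(s) = V(s)^q$ for every $s \in J$, and $V(s) \to +\infty$ as $s$ tends to either endpoint of $J$. -/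
open Set Filter MeasureTheory

/-- If `f` has derivative `g y` at all points `y ≠ x` near `x`, and both are continuous at `x`, then
`f` has derivative `g x` at `x`. -/
theorem hasDerivAt_of_eventually_hasDerivAt_of_ne {f g : ℝ → ℝ} {x : ℝ}
    (f_diff : ∀ᶠ y in nhdsWithin x {x}ᶜ, HasDerivAt f (g y) y) (hf : ContinuousAt f x)
    (hg : ContinuousAt g x) : HasDerivAt f (g x) x := by
  have hR : ∀ᶠ y in nhdsWithin x (Ioi x), HasDerivAt f (g y) y :=
    f_diff.filter_mono (nhdsWithin_mono _ fun _ hy => ne_of_gt hy)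
  have hL : ∀ᶠ y in nhdsWithin x (Iio x), HasDerivAt f (g y) y :=
    f_diff.filter_mono (nhdsWithin_mono _ fun _ hy => ne_of_lt hy)
  have A : HasDerivWithinAt f (g x) (Ici x) x :=
    hasDerivWithinAt_Ici_of_tendsto_deriv (s := {y | HasDerivAt f (g y) y})
      (fun y hy => HasDerivAt.differentiableAt hy |>.differentiableWithinAt)
      hf.continuousWithinAt hR
      ((hg.mono_left nhdsWithin_le_nhds).congr' (hR.mono fun y hy => hy.deriv.symm))
  have B : HasDerivWithinAt f (g x) (Iic x) x :=
    hasDerivWithinAt_Iic_of_tendsto_deriv (s := {y | HasDerivAt f (g y) y})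
      (fun y hy => HasDerivAt.differentiableAt hy |>.differentiableWithinAt)
      hf.continuousWithinAt hL
      ((hg.mono_left nhdsWithin_le_nhds).congr' (hL.mono fun y hy => hy.deriv.symm))
  simpa using B.union A

theorem continuousAt_comp_abs_zero {A : ℝ → ℝ} (hA : ContinuousWithinAt A (Ici 0) 0) :
    ContinuousAt (fun t => A |t|) 0 := by
  have h : Tendsto (fun t : ℝ => |t|) (nhds 0) (nhdsWithin 0 (Ici 0)) :=
    tendsto_nhdsWithin_iff.2
      ⟨by simpa using (continuous_abs (G := ℝ)).tendsto 0, .of_forall fun t => abs_nonneg t⟩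
  simpa [ContinuousAt, Function.comp_def] using hA.tendsto.comp h

/-- The even reflection of a function `A` with derivatives `A' = B` and `B' = C` on `(0, Λ)` and
`B 0 = 0` is twice differentiable on `(-Λ, Λ)`. -/
theorem hasDerivAt_even_reflection {A B C : ℝ → ℝ} {Λ : ℝ}
    (hAB : ∀ t ∈ Ioo 0 Λ, HasDerivAt A (B t) t) (hBC : ∀ t ∈ Ioo 0 Λ, HasDerivAt B (C t) t)
    (hA : ContinuousWithinAt A (Ici 0) 0) (hB : ContinuousWithinAt B (Ici 0) 0)
    (hC : ContinuousWithinAt C (Ici 0) 0) (hB0 : B 0 = 0) :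
    ∀ t, |t| < Λ → HasDerivAt (fun t => A |t|) (B |t| * SignType.sign t) t ∧
      HasDerivAt (fun t => B |t| * SignType.sign t) (C |t|) t := by
  have hne : ∀ t : ℝ, |t| < Λ → t ≠ 0 →
      HasDerivAt (fun t => A |t|) (B |t| * SignType.sign t) t ∧
      HasDerivAt (fun t => B |t| * SignType.sign t) (C |t|) t := by
    intro t ht ht0
    have hmem : |t| ∈ Ioo 0 Λ := ⟨abs_pos.2 ht0, ht⟩
    refine ⟨(hAB _ hmem).comp t (hasDerivAt_abs ht0), ?_⟩
    have h := ((hBC _ hmem).comp t (hasDerivAt_abs ht0)).mul_const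
      ((SignType.sign t : SignType) : ℝ)
    have hs : ((SignType.sign t : SignType) : ℝ) * SignType.sign t = 1 := by
      rcases lt_or_gt_of_ne ht0 with h | h <;> simp [h]
    rw [mul_assoc, hs, mul_one] at h
    refine h.congr_of_eventuallyEq ?_
    have hev : ∀ᶠ y in nhds t, SignType.sign y = SignType.sign t := by
      rcases lt_or_gt_of_ne ht0 with h | h
      · filter_upwards [Iio_mem_nhds h] with y hy
        rw [sign_neg h, sign_neg hy]
      · filter_upwards [Ioi_mem_nhds h] with y hy
        rw [sign_pos h, sign_pos hy]
    filter_upwards [hev] with y hy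
    simp [hy]
  intro t ht
  rcases eq_or_ne t 0 with rfl | ht0
  swap
  · exact hne t ht ht0
  have hΛ : 0 < Λ := by simpa using ht
  have hev : ∀ᶠ y in nhdsWithin (0 : ℝ) {0}ᶜ, |y| < Λ ∧ y ≠ 0 := by
    refine Filter.Eventually.and (nhdsWithin_le_nhds ?_) self_mem_nhdsWithin
    filter_upwards [Ioo_mem_nhds (neg_lt_zero.2 hΛ) hΛ] with y hy
    exact abs_lt.2 hy
  have hGc : ContinuousAt (fun t => B |t| * SignType.sign t) 0 := by
    have hB' := (continuousAt_comp_abs_zero hB).tendsto.norm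
    simp only [abs_zero, hB0, norm_zero] at hB'
    simp only [ContinuousAt, abs_zero, hB0, zero_mul]
    refine squeeze_zero_norm (fun y => ?_) hB'
    rw [norm_mul]
    refine mul_le_of_le_one_right (norm_nonneg _) ?_
    rcases lt_trichotomy y 0 with h | h | h <;> simp [h]
  exact ⟨hasDerivAt_of_eventually_hasDerivAt_of_ne
      (hev.mono fun y hy => (hne y hy.1 hy.2).1) (continuousAt_comp_abs_zero hA) hGc,
    hasDerivAt_of_eventually_hasDerivAt_of_ne (g := fun t => C |t|)
      (hev.mono fun y hy => (hne y hy.1 hy.2).2) hGc (continuousAt_comp_abs_zero hC)⟩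

theorem integrableOn_Ioi_rpow_sub_one_rpow {q : ℝ} (hq : 1 < q) :
    IntegrableOn (fun u : ℝ => (u ^ (q + 1) - 1) ^ (-(1 / 2) : ℝ)) (Ioi 1) := by
  have hmeas : Measurable (fun u : ℝ => (u ^ (q + 1) - 1) ^ (-(1 / 2) : ℝ)) := by fun_prop
  rw [← Ioc_union_Ioi_eq_Ioi (one_le_two : (1 : ℝ) ≤ 2)]
  refine IntegrableOn.union ?_ ?_
  · have h := ((intervalIntegral.intervalIntegrable_rpow' (r := -(1 / 2)) (a := 0) (b := 1)
      (by norm_num)).comp_sub_right 1)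
    rw [intervalIntegrable_iff_integrableOn_Ioc_of_le (by norm_num)] at h
    norm_num only at h
    refine Integrable.mono' h hmeas.aestronglyMeasurable ?_
    filter_upwards [ae_restrict_mem measurableSet_Ioc] with u hu
    have hu1 : u ≤ u ^ (q + 1) := Real.self_le_rpow_of_one_le hu.1.le (by linarith)
    rw [Real.norm_of_nonneg (Real.rpow_nonneg (by linarith [hu.1]) _)]
    exact Real.rpow_le_rpow_of_nonpos (by linarith [hu.1]) (by linarith) (by norm_num)
  · have h := (integrableOn_Ioi_rpow_of_lt (a := (q + 1) * (-(1 / 2))) (c := 2) (by linarith)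
      (by norm_num)).mul_const ((1 / 2 : ℝ) ^ (-(1 / 2) : ℝ))
    refine Integrable.mono' h hmeas.aestronglyMeasurable ?_
    filter_upwards [ae_restrict_mem measurableSet_Ioi] with u hu
    have hu2 : (2 : ℝ) < u := hu
    have hu1 : u ≤ u ^ (q + 1) := Real.self_le_rpow_of_one_le (by linarith) (by linarith)
    rw [Real.norm_of_nonneg (Real.rpow_nonneg (by linarith) _), Real.rpow_mul (by linarith),
      ← Real.mul_rpow (by linarith) (by norm_num)]
    exact Real.rpow_le_rpow_of_nonpos (by linarith) (by linarith) (by norm_num)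

theorem rpow_sub_one_rpow_nonneg {q u : ℝ} (hq : 1 < q) (hu : 1 < u) :
    0 ≤ (u ^ (q + 1) - 1) ^ (-(1 / 2) : ℝ) :=
  Real.rpow_nonneg (sub_nonneg.2 (Real.one_le_rpow hu.le (by linarith))) _

theorem xfun_self (q : ℝ) {vl : ℝ} (hvl : 0 < vl) : xfun q vl vl = 0 := by
  simp [xfun, div_self hvl.ne']

theorem xfun_mono {q vl : ℝ} (hq : 1 < q) (hvl : 0 < vl) : Monotone (fun v => xfun q v vl) := by
  intro v w hvw
  refine mul_le_mul_of_nonneg_left (setIntegral_mono_set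
    ((integrableOn_Ioi_rpow_sub_one_rpow hq).mono_set Ioc_subset_Ioi_self) ?_
    (Ioc_subset_Ioc_right (div_le_div_of_nonneg_right hvw hvl.le)).eventuallyLE) (by positivity)
  filter_upwards [ae_restrict_mem measurableSet_Ioc] with u hu
  exact rpow_sub_one_rpow_nonneg hq hu.1

theorem xfun_le_Lfun {q vl : ℝ} (hq : 1 < q) (hvl : 0 < vl) (v : ℝ) :
    xfun q v vl ≤ Lfun q vl := by
  refine mul_le_mul_of_nonneg_left (setIntegral_mono_set
    (integrableOn_Ioi_rpow_sub_one_rpow hq) ?_ Ioc_subset_Ioi_self.eventuallyLE) (by positivity)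
  filter_upwards [ae_restrict_mem measurableSet_Ioi] with u hu
  exact rpow_sub_one_rpow_nonneg hq hu

theorem hasDerivAt_xfun {q vl v : ℝ} (hq : 1 < q) (hvl : 0 < vl) (hv : vl < v) :
    HasDerivAt (fun v => xfun q v vl)
      (√(4 / (q + 1) * (v ^ (q + 1) - vl ^ (q + 1))))⁻¹ v := by
  have hone : 1 < v / vl := (one_lt_div hvl).2 hv
  have hpow : 1 < (v / vl) ^ (q + 1) := Real.one_lt_rpow hone (by linarith)
  have hmeas : Measurable (fun u : ℝ => (u ^ (q + 1) - 1) ^ (-(1 / 2) : ℝ)) := by fun_prop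
  have hcont : ContinuousAt (fun u : ℝ => (u ^ (q + 1) - 1) ^ (-(1 / 2) : ℝ)) (v / vl) := by
    refine ContinuousAt.rpow_const ?_ (Or.inl (by linarith))
    exact (continuousAt_id.rpow_const (Or.inl (by simp only [id]; linarith))).sub
      continuousAt_const
  have hint : IntervalIntegrable (fun u : ℝ => (u ^ (q + 1) - 1) ^ (-(1 / 2) : ℝ)) volume 1
      (v / vl) := by
    rw [intervalIntegrable_iff_integrableOn_Ioc_of_le hone.le]
    exact (integrableOn_Ioi_rpow_sub_one_rpow hq).mono_set Ioc_subset_Ioi_self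
  have h := ((intervalIntegral.integral_hasDerivAt_right hint
    hmeas.stronglyMeasurable.stronglyMeasurableAtFilter hcont).comp v
    ((hasDerivAt_id v).div_const vl)).const_mul
    (vl ^ ((1 - q) / 2 : ℝ) * ((q + 1) / 4) ^ ((1 : ℝ) / 2))
  have hval : vl ^ ((1 - q) / 2 : ℝ) * ((q + 1) / 4) ^ ((1 : ℝ) / 2) *
      (((v / vl) ^ (q + 1) - 1) ^ (-(1 / 2) : ℝ) * (1 / vl)) =
      (√(4 / (q + 1) * (v ^ (q + 1) - vl ^ (q + 1))))⁻¹ := by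
    have hY : 0 < vl ^ (q + 1) := Real.rpow_pos_of_pos hvl _
    have hX : vl ^ (q + 1) < v ^ (q + 1) := Real.rpow_lt_rpow hvl.le hv (by linarith)
    have hvl' : vl ^ ((1 - q) / 2 : ℝ) = vl * (√(vl ^ (q + 1)))⁻¹ := by
      rw [Real.sqrt_eq_rpow, ← Real.rpow_mul hvl.le, ← Real.rpow_neg hvl.le]
      nth_rewrite 2 [← Real.rpow_one vl]
      rw [← Real.rpow_add hvl]
      congr 1
      ring
    have hsub : v ^ (q + 1) / vl ^ (q + 1) - 1 = (v ^ (q + 1) - vl ^ (q + 1)) / vl ^ (q + 1) := by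
      field_simp
    have hs : 0 < √(vl ^ (q + 1)) := Real.sqrt_pos.2 hY
    rw [hvl', Real.div_rpow (by linarith) hvl.le, hsub, Real.rpow_neg (div_nonneg (by linarith)
      hY.le), ← Real.sqrt_eq_rpow, ← Real.sqrt_eq_rpow,
      Real.sqrt_div (sub_nonneg.2 hX.le), Real.sqrt_mul (by positivity), Real.sqrt_div (by linarith),
      Real.sqrt_div (by norm_num)]
    field_simp
  rw [← hval]
  refine h.congr_of_eventuallyEq ?_
  filter_upwards [Ioi_mem_nhds hv] with w hw
  have hw1 : 1 ≤ w / vl := (one_le_div hvl).2 (le_of_lt hw)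
  simp only [xfun, Function.comp, intervalIntegral.integral_of_le hw1, id]

/-- with `W` the inverse of `v ↦ x(v, v_l)`, the function
`V(s) = W(|s - L/2|)` is twice differentiable on
`J = (L/2 - L(v_l), L/2 + L(v_l))`, satisfies `½ V'' = V^q` on `J`
(i.e. `V'' = 2 V^q`), and `V(s) → +∞` as `s` tends to either endpoint of `J`. -/
theorem stmt7 (q vl L : ℝ) (hq : 1 < q) (hvl : 0 < vl) (hL : 0 < L)
    (W : ℝ → ℝ)
    (hW1 : ∀ v ∈ Set.Ici vl, W (xfun q v vl) = v)
    (hW2 : ∀ s ∈ Set.Ico 0 (Lfun q vl), W s ∈ Set.Ici vl ∧ xfun q (W s) vl = s) :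
    ∃ V' : ℝ → ℝ,
      (∀ s ∈ Set.Ioo (L / 2 - Lfun q vl) (L / 2 + Lfun q vl),
        HasDerivAt (fun t => W |t - L / 2|) (V' s) s) ∧
      (∀ s ∈ Set.Ioo (L / 2 - Lfun q vl) (L / 2 + Lfun q vl),
        HasDerivAt V' (2 * (W |s - L / 2|) ^ q) s) ∧
      Tendsto (fun s => W |s - L / 2|)
        (nhdsWithin (L / 2 - Lfun q vl) (Set.Ioo (L / 2 - Lfun q vl) (L / 2 + Lfun q vl)))
        atTop ∧
      Tendsto (fun s => W |s - L / 2|)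
        (nhdsWithin (L / 2 + Lfun q vl) (Set.Ioo (L / 2 - Lfun q vl) (L / 2 + Lfun q vl)))
        atTop := by
  set Λ := Lfun q vl
  set F : ℝ → ℝ := fun v => xfun q v vl with hF
  have hmono : Monotone F := xfun_mono hq hvl
  have hF0 : F vl = 0 := xfun_self q hvl
  have hFstrict : StrictMonoOn F (Ici vl) := fun v hv w hw hvw =>
    (hmono hvw.le).lt_of_ne fun h => hvw.ne (by rw [← hW1 v hv, ← hW1 w hw]; exact congrArg W h)
  have hFmem : ∀ v ∈ Ici vl, F v ∈ Ico 0 Λ := fun v hv => by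
    have hv' : vl ≤ v := hv
    refine ⟨hF0 ▸ hmono hv', ?_⟩
    exact (hFstrict hv (show vl ≤ v + 1 by linarith) (lt_add_one v)).trans_le
      (xfun_le_Lfun hq hvl _)
  have hWmono : StrictMonoOn W (Ico 0 Λ) := fun s hs t ht hst => by
    by_contra! h
    have h' := hmono h
    simp only [hF, (hW2 s hs).2, (hW2 t ht).2] at h'
    exact hst.not_ge h'
  have hΛ : 0 < Λ := (hFmem vl self_mem_Ici).1.trans_lt (hFmem vl self_mem_Ici).2
  have h0mem : (0 : ℝ) ∈ Ico 0 Λ := ⟨le_rfl, hΛ⟩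
  have hW0 : W 0 = vl := by rw [← hF0]; exact hW1 vl self_mem_Ici
  have hWr : ∀ s ∈ Ico 0 Λ, ContinuousWithinAt W (Ici s) s := fun s hs => by
    refine hWmono.continuousWithinAt_right_of_exists_between
      (mem_of_superset (Ico_mem_nhdsGE hs.2) (Ico_subset_Ico_left hs.1)) fun b hb => ?_
    have hb' : b ∈ Ici vl := (mem_Ici.1 (hW2 s hs).1).trans hb.le
    exact ⟨F b, hFmem b hb', by rw [hW1 b hb']; exact ⟨hb, le_rfl⟩⟩
  have hWgt : ∀ s ∈ Ioo 0 Λ, vl < W s := fun s hs =>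
    hW0 ▸ hWmono h0mem (Ioo_subset_Ico_self hs) hs.1
  have hWc : ∀ s ∈ Ioo 0 Λ, ContinuousAt W s := fun s hs => by
    refine continuousAt_iff_continuous_left_right.2 ⟨?_, hWr s (Ioo_subset_Ico_self hs)⟩
    refine hWmono.continuousWithinAt_left_of_exists_between
      (nhdsWithin_le_nhds (Ico_mem_nhds hs.1 hs.2)) fun b hb => ?_
    have hb' : max b vl ∈ Ici vl := le_max_right b vl
    exact ⟨F (max b vl), hFmem _ hb', by
      rw [hW1 _ hb']; exact ⟨le_max_left _ _, max_lt hb (hWgt s hs)⟩⟩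
  set g : ℝ → ℝ := fun v => √(4 / (q + 1) * (v ^ (q + 1) - vl ^ (q + 1))) with hg
  have hrad : ∀ v, vl < v → 0 < 4 / (q + 1) * (v ^ (q + 1) - vl ^ (q + 1)) := fun v hv =>
    mul_pos (by positivity) (sub_pos.2 (Real.rpow_lt_rpow hvl.le hv (by linarith)))
  have hW' : ∀ s ∈ Ioo 0 Λ, HasDerivAt W (g (W s)) s := fun s hs => by
    have h := HasDerivAt.of_local_left_inverse (hWc s hs) (hasDerivAt_xfun hq hvl (hWgt s hs))
      (inv_ne_zero (Real.sqrt_pos.2 (hrad _ (hWgt s hs))).ne')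
      (mem_of_superset (Ioo_mem_nhds hs.1 hs.2) fun t ht => (hW2 t (Ioo_subset_Ico_self ht)).2)
    rwa [inv_inv] at h
  have hW'' : ∀ s ∈ Ioo 0 Λ, HasDerivAt (fun t => g (W t)) (2 * W s ^ q) s := fun s hs => by
    have hpos : 0 < g (W s) := Real.sqrt_pos.2 (hrad _ (hWgt s hs))
    have h := ((((hW' s hs).rpow_const (p := q + 1) (Or.inl (hvl.trans (hWgt s hs)).ne')).sub_const
      (vl ^ (q + 1))).const_mul (4 / (q + 1))).sqrt (hrad _ (hWgt s hs)).ne'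
    convert h using 1
    have hq1 : q + 1 ≠ 0 := by linarith
    change _ = _ / (2 * g (W s))
    rw [add_sub_cancel_right]
    field_simp
    ring
  have hgc : Continuous g := by
    have := Real.continuous_rpow_const (q := q + 1) (by linarith)
    fun_prop
  have hWr0 := hWr 0 h0mem
  have key := hasDerivAt_even_reflection hW' hW'' hWr0 (hgc.continuousAt.comp_continuousWithinAt hWr0)
    (continuousWithinAt_const.mul (hWr0.rpow_const (Or.inr (by linarith)))) (by simp [hg, hW0])
  have habs : ∀ s ∈ Ioo (L / 2 - Λ) (L / 2 + Λ), |s - L / 2| < Λ := fun s hs =>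
    abs_lt.2 ⟨by linarith [hs.1], by linarith [hs.2]⟩
  have hlim : ∀ e : ℝ, |e - L / 2| = Λ → Tendsto (fun s => W |s - L / 2|)
      (nhdsWithin e (Ioo (L / 2 - Λ) (L / 2 + Λ))) atTop := fun e he => by
    refine tendsto_atTop.2 fun M => ?_
    have hM : max M vl ∈ Ici vl := le_max_right M vl
    have hc : ContinuousAt (fun s : ℝ => |s - L / 2|) e := by fun_prop
    have hev := hc.eventually_const_lt (he ▸ (hFmem _ hM).2)
    filter_upwards [nhdsWithin_le_nhds hev, self_mem_nhdsWithin] with s hs hsJ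
    have h := hWmono (hFmem _ hM) ⟨abs_nonneg _, habs s hsJ⟩ hs
    rw [hW1 _ hM] at h
    exact (le_max_left M vl).trans h.le
  refine ⟨fun s => g (W |s - L / 2|) * SignType.sign (s - L / 2), fun s hs => ?_, fun s hs => ?_,
    hlim _ ?_, hlim _ ?_⟩
  · exact (key _ (habs s hs)).1.comp_sub_const s (L / 2)
  · exact (key _ (habs s hs)).2.comp_sub_const s (L / 2)
  · rw [sub_sub_cancel_left, abs_neg, abs_of_pos hΛ]
  · rw [add_sub_cancel_left, abs_of_pos hΛ]
end
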